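/- arXiv:math-ph/0506056 — 3 statements merged into one kernel-verified Lean document; each statement's English description precedes it below -/
import Mathlib

section
/- Let k ≥ 1 and let T_k be the Walsh-quantized open baker's matrix of size 3^k. Then the algebraic multiplicity of 0 as a root of the characteristic polynomial of T_k equals 3^k − 2^k; equivalently, the generalized eigenspaces of T_k associated with its nonzero eigenvalues span a subspace of dimension 2^k. -/
/-- The 3×3 matrix `M` with entries `M_{a,b} = 3^{-1/2}·exp(2πi·a·b/3)` for
`b ∈ {0,2}` and `M_{a,1} = 0`. -/
noncomputable def Mbaker : Matrix (Fin 3) (Fin 3) ℂ :=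
  Matrix.of fun a b : Fin 3 =>
    if b = 1 then 0
    else ((Real.sqrt 3 : ℝ) : ℂ)⁻¹ *
      Complex.exp (2 * Real.pi * Complex.I * (a : ℕ) * (b : ℕ) / 3)

/-- The Walsh-quantized open baker's matrix `T_k` of size `3^k`, indexed by words
`ε ∈ {0,1,2}^k`: `(T_k)_{ε',ε} = M_{ε'_{k-1}, ε_0}` if `ε'_i = ε_{i+1}` for all
`0 ≤ i ≤ k-2`, and `0` otherwise. -/
noncomputable def Tbaker : (k : ℕ) → Matrix (Fin k → Fin 3) (Fin k → Fin 3) ℂ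
  | 0 => 0
  | (k + 1) => Matrix.of fun ε' ε =>
      if ∀ i : Fin k, ε' i.castSucc = ε i.succ then Mbaker (ε' (Fin.last k)) (ε 0) else 0

open Polynomial in
/-- If a square matrix is block triangular and every diagonal block except the one labelled `c`
vanishes, its characteristic polynomial is that of the block `c` times a power of `X`. -/
theorem Matrix.BlockTriangular.exists_charpoly_eq_X_pow_mul {R n α : Type*} [CommRing R]
    [Fintype n] [DecidableEq n] [LinearOrder α] {M : Matrix n n R} {b : n → α}
    (h : M.BlockTriangular b) (c : α) (h0 : ∀ a ≠ c, M.toSquareBlock b a = 0) :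
    ∃ N : ℕ, M.charpoly = X ^ N * (M.toSquareBlock b c).charpoly := by
  classical
  have hprod (s : Finset α) (hs : c ∉ s) :
      ∃ N : ℕ, ∏ a ∈ s, (M.toSquareBlock b a).charpoly = X ^ N := by
    refine ⟨∑ a ∈ s, Fintype.card {i // b i = a}, ?_⟩
    rw [← Finset.prod_pow_eq_pow_sum]
    refine Finset.prod_congr rfl fun a ha => ?_
    rw [h0 a (ne_of_mem_of_not_mem ha hs), Matrix.charpoly_zero]
  rw [h.charpoly]
  by_cases hc : c ∈ Finset.univ.image b
  · rw [← Finset.prod_erase_mul _ _ hc]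
    obtain ⟨N, hN⟩ := hprod _ (Finset.notMem_erase c (Finset.univ.image b))
    exact ⟨N, by rw [hN]⟩
  · obtain ⟨N, hN⟩ := hprod _ hc
    have : IsEmpty {i // b i = c} := ⟨fun i => hc (Finset.mem_image.2 ⟨i, Finset.mem_univ _, i.2⟩)⟩
    exact ⟨N, by rw [hN, Matrix.charpoly_isEmpty, mul_one]⟩

open Polynomial in
theorem Matrix.BlockTriangular.rootMultiplicity_charpoly_zero {R n α : Type*} [CommRing R]
    [IsDomain R] [Fintype n] [DecidableEq n] [LinearOrder α] {M : Matrix n n R} {b : n → α}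
    (h : M.BlockTriangular b) (c : α) (h0 : ∀ a ≠ c, M.toSquareBlock b a = 0)
    (hc : (M.toSquareBlock b c).det ≠ 0) :
    M.charpoly.rootMultiplicity 0 = Fintype.card n - Fintype.card {i // b i = c} := by
  obtain ⟨N, hN⟩ := h.exists_charpoly_eq_X_pow_mul c h0
  have hdeg := congrArg natDegree hN
  rw [(monic_X_pow N).natDegree_mul (Matrix.charpoly_monic _), natDegree_X_pow,
    Matrix.charpoly_natDegree_eq_dim, Matrix.charpoly_natDegree_eq_dim] at hdeg
  have hroot : rootMultiplicity 0 (M.toSquareBlock b c).charpoly = 0 := by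
    refine rootMultiplicity_eq_zero fun hr => hc ?_
    rw [Matrix.det_eq_sign_charpoly_coeff, coeff_zero_eq_eval_zero, hr.eq_zero, mul_zero]
  have hX : rootMultiplicity 0 (X ^ N : R[X]) = N := by
    simpa using rootMultiplicity_X_sub_C_pow (0 : R) N
  rw [hN, rootMultiplicity_mul ((monic_X_pow N).mul (Matrix.charpoly_monic _)).ne_zero, hX, hroot]
  omega

/-- The position of the first letter `1` of a word, or its length if there is none. -/
def firstOne {k : ℕ} (ε : Fin k → Fin 3) : ℕ :=
  Nat.find (p := fun m => ∀ h : m < k, ε ⟨m, h⟩ = 1) ⟨k, fun h => absurd h (lt_irrefl k)⟩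

theorem firstOne_le_of_forall {k m : ℕ} {ε : Fin k → Fin 3} (h : ∀ h : m < k, ε ⟨m, h⟩ = 1) :
    firstOne ε ≤ m :=
  Nat.find_min' _ h

theorem firstOne_le {k : ℕ} (ε : Fin k → Fin 3) : firstOne ε ≤ k :=
  firstOne_le_of_forall fun h => absurd h (lt_irrefl k)

theorem apply_firstOne {k : ℕ} {ε : Fin k → Fin 3} (h : firstOne ε < k) :
    ε ⟨firstOne ε, h⟩ = 1 :=
  Nat.find_spec (p := fun m => ∀ h : m < k, ε ⟨m, h⟩ = 1) _ h

theorem firstOne_eq_length_iff {k : ℕ} {ε : Fin k → Fin 3} :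
    firstOne ε = k ↔ ∀ i, ε i ≠ 1 := by
  constructor
  · intro h i hi
    have := firstOne_le_of_forall (ε := ε) (m := i) fun _ => hi
    have := i.2
    omega
  · intro h
    by_contra hne
    exact h _ (apply_firstOne (lt_of_le_of_ne (firstOne_le ε) hne))

theorem card_firstOne_eq_length (k : ℕ) :
    Fintype.card {ε : Fin k → Fin 3 // firstOne ε = k} = 2 ^ k := by
  have e : {ε : Fin k → Fin 3 // firstOne ε = k} ≃ (Fin k → {a : Fin 3 // a ≠ 1}) :=
    (Equiv.subtypeEquivRight fun _ => firstOne_eq_length_iff).trans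
      (Equiv.subtypePiEquivPi (p := fun (_ : Fin k) (a : Fin 3) => a ≠ 1))
  rw [Fintype.card_congr e]
  simp [Fintype.card_subtype_compl]

theorem Mbaker_apply_one (a : Fin 3) : Mbaker a 1 = 0 := by
  simp [Mbaker]

theorem Tbaker_succ_apply (n : ℕ) (ε' ε : Fin (n + 1) → Fin 3) :
    Tbaker (n + 1) ε' ε =
      if ∀ i : Fin n, ε' i.castSucc = ε i.succ then Mbaker (ε' (Fin.last n)) (ε 0) else 0 :=
  rfl

theorem firstOne_lt_of_Tbaker_ne_zero {n : ℕ} {ε' ε : Fin (n + 1) → Fin 3}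
    (h : Tbaker (n + 1) ε' ε ≠ 0) (hε : firstOne ε < n + 1) : firstOne ε' < firstOne ε := by
  rw [Tbaker_succ_apply] at h
  split_ifs at h with hs
  · have h1 := apply_firstOne hε
    rcases hm : firstOne ε with _ | m
    · simp only [hm] at h1
      exact absurd (by rw [show ε 0 = 1 from h1]; exact Mbaker_apply_one _) h
    · rw [hm] at hε
      simp only [hm] at h1
      exact Nat.lt_succ_of_le (firstOne_le_of_forall fun _ =>
        (hs ⟨m, Nat.lt_of_succ_lt_succ hε⟩).trans h1)
  · exact absurd rfl h

theorem Tbaker_blockTriangular (n : ℕ) : (Tbaker (n + 1)).BlockTriangular firstOne := by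
  intro ε' ε hlt
  by_contra h
  exact lt_asymm hlt
    (firstOne_lt_of_Tbaker_ne_zero h (lt_of_lt_of_le hlt (firstOne_le ε')))

theorem Tbaker_toSquareBlock_eq_zero (n : ℕ) {a : ℕ} (ha : a ≠ n + 1) :
    (Tbaker (n + 1)).toSquareBlock firstOne a = 0 := by
  ext ⟨ε', h'⟩ ⟨ε, h⟩
  by_contra hne
  have hle := firstOne_le ε
  have := firstOne_lt_of_Tbaker_ne_zero (ε' := ε') (ε := ε) hne (by omega)
  omega

/-- The submatrix of `Mbaker` on the indices `0` and `2` is injective. -/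
theorem eq_zero_of_Mbaker {x y : ℂ} (h0 : Mbaker 0 0 * x + Mbaker 0 2 * y = 0)
    (h2 : Mbaker 2 0 * x + Mbaker 2 2 * y = 0) : x = 0 ∧ y = 0 := by
  have hs : ((Real.sqrt 3 : ℝ) : ℂ)⁻¹ ≠ 0 := by simp
  have hω : Complex.exp (2 * Real.pi * Complex.I * 2 * 2 / 3) ≠ 1 := by
    intro h
    obtain ⟨m, hm⟩ := Complex.exp_eq_one_iff.1 h
    have h43 : (4 : ℂ) = 3 * m := by
      have hpi := Complex.two_pi_I_ne_zero
      apply mul_right_cancel₀ hpi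
      linear_combination 3 * hm
    have : (4 : ℤ) = 3 * m := by exact_mod_cast h43
    omega
  simp only [Mbaker, Matrix.of_apply, show (2 : Fin 3) ≠ 1 by decide, if_false] at h0 h2
  norm_num at h0 h2
  norm_num at hω
  have e0 : x + y = 0 := by
    apply mul_left_cancel₀ hs
    linear_combination h0
  have e2 : x + Complex.exp (2 * Real.pi * Complex.I * 2 * 2 / 3) * y = 0 := by
    apply mul_left_cancel₀ hs
    linear_combination h2
  have hy : y = 0 := by
    have : (Complex.exp (2 * Real.pi * Complex.I * 2 * 2 / 3) - 1) * y = 0 := by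
      linear_combination e2 - e0
    exact (mul_eq_zero.1 this).resolve_left (sub_ne_zero.2 hω)
  exact ⟨by simpa [hy] using e0, hy⟩

theorem det_Tbaker_toSquareBlock_ne_zero (n : ℕ) :
    ((Tbaker (n + 1)).toSquareBlock firstOne (n + 1)).det ≠ 0 := by
  intro hdet
  obtain ⟨v, hv, hTv⟩ := Matrix.exists_mulVec_eq_zero_iff.2 hdet
  refine hv (funext fun ⟨ε, hε⟩ => ?_)
  have hε1 := firstOne_eq_length_iff.1 hε
  set w : Fin n → Fin 3 := Fin.tail ε with hw
  have hw1 : ∀ i, w i ≠ 1 := fun i => hε1 i.succ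
  have hcons (a : Fin 3) (ha : a ≠ 1) : firstOne (Fin.cons a w : Fin (n + 1) → Fin 3) = n + 1 :=
    firstOne_eq_length_iff.2 (Fin.cases (by simpa using ha) (by simpa using hw1))
  have hsnoc (a : Fin 3) (ha : a ≠ 1) :
      firstOne (Fin.snoc w a : Fin (n + 1) → Fin 3) = n + 1 :=
    firstOne_eq_length_iff.2 (Fin.lastCases (by simpa using ha) (by simpa using hw1))
  have row (c : Fin 3) (hc : c ≠ 1) :
      Mbaker c 0 * v ⟨Fin.cons 0 w, hcons 0 (by decide)⟩ +
        Mbaker c 2 * v ⟨Fin.cons 2 w, hcons 2 (by decide)⟩ = 0 := by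
    have := congrFun hTv ⟨Fin.snoc w c, hsnoc c hc⟩
    simp only [Matrix.mulVec, dotProduct, Pi.zero_apply] at this
    rw [Fintype.sum_eq_add (⟨Fin.cons 0 w, hcons 0 (by decide)⟩ : {ε // firstOne ε = n + 1})
      ⟨Fin.cons 2 w, hcons 2 (by decide)⟩] at this
    · simpa [Matrix.toSquareBlock_def, Tbaker_succ_apply] using this
    · intro h
      simpa using congrFun (congrArg Subtype.val h) 0
    · rintro ⟨δ, hδ⟩ ⟨h0, h2⟩
      simp only [Matrix.toSquareBlock_def, Matrix.of_apply, Tbaker_succ_apply, Fin.snoc_castSucc]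
      rw [if_neg, zero_mul]
      intro hs
      have hδw : δ = Fin.cons (δ 0) w := by
        rw [show w = Fin.tail δ from funext hs, Fin.cons_self_tail]
      have hδ1 := firstOne_eq_length_iff.1 hδ 0
      have : δ 0 = 0 ∨ δ 0 = 2 := by
        generalize δ 0 = a at hδ1
        revert a
        decide
      rcases this with h | h <;> rw [h] at hδw
      · exact h0 (Subtype.ext hδw)
      · exact h2 (Subtype.ext hδw)
  obtain ⟨hx, hy⟩ := eq_zero_of_Mbaker (row 0 (by decide)) (row 2 (by decide))
  have hεw : ε = Fin.cons (ε 0) w := (Fin.cons_self_tail ε).symm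
  have : ε 0 = 0 ∨ ε 0 = 2 := by
    have := hε1 0
    generalize ε 0 = a at this
    revert a
    decide
  rcases this with h | h <;> rw [h] at hεw
  · exact (congrArg v (Subtype.ext hεw)).trans hx
  · exact (congrArg v (Subtype.ext hεw)).trans hy

/-- for `k ≥ 1`, the algebraic multiplicity of `0` as a root of the
characteristic polynomial of `T_k` equals `3^k − 2^k`. -/
theorem stmt_4 (k : ℕ) (hk : 1 ≤ k) :
    (Matrix.charpoly (Tbaker k)).rootMultiplicity 0 = 3 ^ k - 2 ^ k := by
  obtain ⟨n, rfl⟩ := Nat.exists_eq_add_of_le' hk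
  rw [(Tbaker_blockTriangular n).rootMultiplicity_charpoly_zero (n + 1)
    (fun _ => Tbaker_toSquareBlock_eq_zero n) (det_Tbaker_toSquareBlock_ne_zero n),
    card_firstOne_eq_length]
  simp
end

section
/- Let T_k be the Walsh-quantized open baker's matrix of size 3^k and set ρ = (|λ₊|·|λ₋|)^{1/2} = 3^{−1/4}. Then for every continuous function f : ℂ → ℂ, lim_{k→∞} 2^{−k} · Σ_{λ} mult(λ)·f(λ) = (1/2π) ∫₀^{2π} f(ρ·e^{iθ}) dθ, where the sum runs over the nonzero eigenvalues λ of T_k and mult(λ) is the algebraic multiplicity of λ as a root of the characteristic polynomial of T_k. -/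
open Polynomial in
/-- The determinant of a polynomial in a matrix is the product of its values at the eigenvalues. -/
theorem det_aeval_eq_prod_roots_charpoly {n K : Type*} [Fintype n] [DecidableEq n] [Field K]
    [IsAlgClosed K] (A : Matrix n n K) (q : K[X]) :
    (aeval A q).det = (A.charpoly.roots.map q.eval).prod := by
  have hcard : A.charpoly.roots.card = Fintype.card n := by
    rw [← (IsAlgClosed.splits A.charpoly).natDegree_eq_card_roots,
      Matrix.charpoly_natDegree_eq_dim]
  have hlin (r : K) : (aeval A (X - C r)).det = (A.charpoly.roots.map (X - C r).eval).prod := by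
    have h := congrArg (eval r)
      ((IsAlgClosed.splits A.charpoly).eq_prod_roots_of_monic A.charpoly_monic)
    rw [Matrix.eval_charpoly, eval_multiset_prod, Multiset.map_map] at h
    have hneg : aeval A (X - C r) = -(Matrix.scalar n r - A) := by
      simp [Algebra.algebraMap_eq_smul_one, Matrix.smul_one_eq_diagonal]
    rw [hneg, Matrix.det_neg, h, ← hcard]
    simpa [Function.comp_def] using
      (Multiset.prod_map_neg (A.charpoly.roots.map fun z => r - z)).symm
  have hsplit := (IsAlgClosed.splits q).eq_prod_roots
  have hprod (s : Multiset K) : (aeval A (s.map (X - C ·)).prod).det =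
      (A.charpoly.roots.map (s.map (X - C ·)).prod.eval).prod := by
    induction s using Multiset.induction_on with
    | empty => simp
    | cons r s ih =>
      simp only [Multiset.map_cons, Multiset.prod_cons, map_mul, Matrix.det_mul, eval_mul,
        Multiset.prod_map_mul, hlin, ih]
  rw [hsplit]
  simp only [map_mul, Matrix.det_mul, hprod, eval_mul, Multiset.prod_map_mul]
  simp [Algebra.algebraMap_eq_smul_one, hcard]

open Polynomial in
/-- The trace of a polynomial in a matrix is the sum of its values at the eigenvalues. -/
theorem trace_aeval_eq_sum_roots_charpoly {n K : Type*} [Fintype n] [DecidableEq n] [Field K]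
    [IsAlgClosed K] (A : Matrix n n K) (q : K[X]) :
    (aeval A q).trace = (A.charpoly.roots.map q.eval).sum := by
  have h : (aeval A q).charpoly = ((A.charpoly.roots.map q.eval).map (X - C ·)).prod := by
    have : Infinite K := IsAlgClosed.instInfinite
    refine Polynomial.funext fun t => ?_
    have ht : Matrix.scalar n t - aeval A q = aeval A (C t - q) := by
      simp [Algebra.algebraMap_eq_smul_one, Matrix.smul_one_eq_diagonal]
    rw [Matrix.eval_charpoly, ht, det_aeval_eq_prod_roots_charpoly, eval_multiset_prod]
    simp [Multiset.map_map]
  rw [Matrix.trace_eq_sum_roots_charpoly, h, roots_multiset_prod_X_sub_C]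

open Polynomial in
/-- If `A ^ K` is diagonal, sums of `z ^ n * F (z ^ K)` over the eigenvalues of `A`
are weighted traces of `A ^ n`. -/
theorem sum_roots_charpoly_pow_mul_apply_pow {n : Type*} [Fintype n] [DecidableEq n]
    {A : Matrix n n ℂ} {K : ℕ} {w : n → ℂ} (hA : A ^ K = Matrix.diagonal w) (m : ℕ) (F : ℂ → ℂ) :
    (A.charpoly.roots.map fun z => z ^ m * F (z ^ K)).sum = ∑ i, (A ^ m) i i * F (w i) := by
  classical
  set s : Finset ℂ := (A.charpoly.roots.map (· ^ K)).toFinset ∪ Finset.univ.image w with hs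
  set p := Lagrange.interpolate s id F
  have hp : ∀ x ∈ s, p.eval x = F x := fun x hx =>
    Lagrange.eval_interpolate_at_node F (Set.injOn_id _) hx
  have h := trace_aeval_eq_sum_roots_charpoly A (X ^ m * p.comp (X ^ K))
  have hdiag : aeval A (p.comp (X ^ K)) = Matrix.diagonal (F ∘ w) := by
    rw [aeval_comp, map_pow, aeval_X, hA, ← Matrix.diagonalAlgHom_apply ℂ, aeval_algHom_apply,
      Matrix.diagonalAlgHom_apply]
    congr 1
    ext i
    rw [aeval_pi_apply, Function.comp_apply, ← hp (w i) (by simp [hs])]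
    simp [coe_aeval_eq_eval]
  rw [map_mul, hdiag, map_pow, aeval_X] at h
  rw [Matrix.trace] at h
  simp only [Matrix.diag_apply, Matrix.mul_diagonal, Function.comp_apply] at h
  rw [h]
  congr 1
  refine Multiset.map_congr rfl fun z hz => ?_
  simp only [eval_mul, eval_pow, eval_X, eval_comp]
  rw [hp]
  simp only [hs, Finset.mem_union, Multiset.mem_toFinset, Multiset.mem_map]
  exact Or.inl ⟨z, hz, rfl⟩

/-- The open baker's matrix attached to a one-letter matrix `A`. -/
def shiftMatrix {ι R : Type*} [DecidableEq ι] [Zero R] (A : Matrix ι ι R) (k : ℕ) :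
    Matrix (Fin (k + 1) → ι) (Fin (k + 1) → ι) R :=
  Matrix.of fun ε' ε =>
    if ∀ i : Fin k, ε' i.castSucc = ε i.succ then A (ε' (Fin.last k)) (ε 0) else 0

/-- The Kronecker power of a matrix, indexed by words. -/
def tensorPow {ι R : Type*} [CommMonoid R] (P : Matrix ι ι R) (k : ℕ) :
    Matrix (Fin k → ι) (Fin k → ι) R :=
  Matrix.of fun ε' ε => ∏ i, P (ε' i) (ε i)

theorem tensorPow_mul {ι R : Type*} [Fintype ι] [DecidableEq ι] [CommRing R] (P Q : Matrix ι ι R)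
    (k : ℕ) : tensorPow P k * tensorPow Q k = tensorPow (P * Q) k := by
  ext ε' ε
  simp only [tensorPow, Matrix.mul_apply, Matrix.of_apply, ← Finset.prod_mul_distrib]
  rw [Finset.prod_univ_sum, Fintype.piFinset_univ]

theorem tensorPow_one {ι R : Type*} [DecidableEq ι] [CommRing R] (k : ℕ) :
    tensorPow (1 : Matrix ι ι R) k = 1 := by
  ext ε' ε
  simp only [tensorPow, Matrix.of_apply, Matrix.one_apply]
  by_cases h : ε' = ε
  · simp [h]
  · obtain ⟨i, hi⟩ := Function.ne_iff.mp h
    rw [if_neg h]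
    exact Finset.prod_eq_zero (Finset.mem_univ i) (if_neg hi)

/-- Intertwining of one-letter matrices lifts to the shift matrices. -/
theorem shiftMatrix_mul_tensorPow {ι R : Type*} [Fintype ι] [DecidableEq ι] [CommRing R]
    {A B P : Matrix ι ι R} (h : A * P = P * B) (k : ℕ) :
    shiftMatrix A k * tensorPow P (k + 1) = tensorPow P (k + 1) * shiftMatrix B k := by
  ext ε' η
  have hl : (shiftMatrix A k * tensorPow P (k + 1)) ε' η =
      (A * P) (ε' (Fin.last k)) (η 0) * ∏ i : Fin k, P (ε' i.castSucc) (η i.succ) := by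
    rw [Matrix.mul_apply, ← (Fin.consEquiv fun _ => ι).sum_comp, Fintype.sum_prod_type,
      Matrix.mul_apply, Finset.sum_mul]
    refine Finset.sum_congr rfl fun a _ => ?_
    rw [Finset.sum_eq_single (fun i => ε' i.castSucc)]
    · simp [shiftMatrix, tensorPow, Fin.consEquiv, Fin.prod_univ_succ, mul_assoc]
    · intro v _ hv
      have : ¬ ∀ i : Fin k, ε' i.castSucc = v i := fun h => hv (funext fun i => (h i).symm)
      simp [shiftMatrix, Fin.consEquiv, this]
    · simp
  have hr : (tensorPow P (k + 1) * shiftMatrix B k) ε' η =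
      (P * B) (ε' (Fin.last k)) (η 0) * ∏ i : Fin k, P (ε' i.castSucc) (η i.succ) := by
    rw [Matrix.mul_apply, ← (Fin.snocEquiv fun _ => ι).sum_comp, Fintype.sum_prod_type,
      Matrix.mul_apply, Finset.sum_mul]
    refine Finset.sum_congr rfl fun a _ => ?_
    rw [Finset.sum_eq_single (Fin.tail η)]
    · simp [shiftMatrix, tensorPow, Fin.snocEquiv, Fin.prod_univ_castSucc, Fin.tail]
      ring
    · intro v _ hv
      have : ¬ ∀ i : Fin k, v i = η i.succ := fun h => hv (funext h)
      simp [shiftMatrix, Fin.snocEquiv, this]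
    · simp
  rw [hl, hr, h]

theorem charpoly_shiftMatrix_eq {ι R : Type*} [Fintype ι] [DecidableEq ι] [CommRing R]
    {A B P : Matrix ι ι R} (hP : IsUnit P) (h : A * P = P * B) (k : ℕ) :
    (shiftMatrix A k).charpoly = (shiftMatrix B k).charpoly := by
  obtain ⟨P, rfl⟩ := hP
  set Q : Matrix ι ι R := ↑P⁻¹
  have h₁ : tensorPow (P : Matrix ι ι R) (k + 1) * tensorPow Q (k + 1) = 1 := by
    rw [tensorPow_mul, Units.mul_inv, tensorPow_one]
  have h₂ : tensorPow Q (k + 1) * tensorPow (P : Matrix ι ι R) (k + 1) = 1 := by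
    rw [tensorPow_mul, Units.inv_mul, tensorPow_one]
  calc (shiftMatrix A k).charpoly
      = (shiftMatrix A k * tensorPow (P : Matrix ι ι R) (k + 1) *
          tensorPow Q (k + 1)).charpoly := by rw [mul_assoc, h₁, mul_one]
    _ = (shiftMatrix B k).charpoly := by
      rw [shiftMatrix_mul_tensorPow h, Matrix.charpoly_mul_comm, ← mul_assoc, h₂, one_mul]

open scoped Fin.CommRing in
/-- The powers of the shift matrix of a diagonal matrix are monomial matrices. -/
theorem shiftMatrix_diagonal_pow_apply {ι R : Type*} [Fintype ι] [DecidableEq ι] [CommRing R]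
    (d : ι → R) (k n : ℕ) (ε' ε : Fin (k + 1) → ι) :
    (shiftMatrix (Matrix.diagonal d) k ^ n) ε' ε =
      if ε' = fun i => ε (i + (n : Fin (k + 1))) then
        ∏ j ∈ Finset.range n, d (ε (j : Fin (k + 1))) else 0 := by
  have hone (η' η : Fin (k + 1) → ι) : shiftMatrix (Matrix.diagonal d) k η' η =
      if η' = fun i => η (i + 1) then d (η 0) else 0 := by
    have hiff : (η' = fun i => η (i + 1)) ↔
        (∀ i : Fin k, η' i.castSucc = η i.succ) ∧ η' (Fin.last k) = η 0 := by
      rw [funext_iff, Fin.forall_fin_succ']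
      simp
    simp only [shiftMatrix, Matrix.of_apply, Matrix.diagonal_apply, hiff, ite_and]
    split_ifs with h₁ h₂ <;> simp_all
  induction n generalizing ε' with
  | zero => simp [Matrix.one_apply]
  | succ n ih =>
    rw [pow_succ', Matrix.mul_apply,
      Finset.sum_eq_single fun i => ε (i + (n : Fin (k + 1)))]
    · rw [hone, ih, if_pos rfl, Finset.prod_range_succ]
      have : (fun i : Fin (k + 1) => ε (i + ((n + 1 : ℕ) : Fin (k + 1)))) =
          fun i => ε (i + 1 + (n : Fin (k + 1))) := by
        funext i
        congr 1
        push_cast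
        abel
      rw [this]
      simp [mul_comm]
    · intro η _ hη
      rw [ih, if_neg hη, mul_zero]
    · simp

open scoped Fin.CommRing in
theorem shiftMatrix_diagonal_pow_length {ι R : Type*} [Fintype ι] [DecidableEq ι] [CommRing R]
    (d : ι → R) (k : ℕ) :
    shiftMatrix (Matrix.diagonal d) k ^ (k + 1) = Matrix.diagonal fun ε => ∏ i, d (ε i) := by
  ext ε' ε
  have hcast : ((k + 1 : ℕ) : Fin (k + 1)) = 0 := by simp
  rw [shiftMatrix_diagonal_pow_apply, hcast, Matrix.diagonal_apply, Finset.prod_range]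
  simp only [add_zero, Fin.cast_val_eq_self]
  split_ifs with h
  · rw [h]
  · rfl

open scoped Fin.CommRing in
/-- There are at most `|ι| ^ n` words of length `k + 1` that are fixed by the `n`-th shift. -/
theorem card_filter_shift_eq_le {ι : Type*} [Fintype ι] [DecidableEq ι] {k n : ℕ} (hn : 0 < n) :
    (Finset.univ.filter fun ε : Fin (k + 1) → ι =>
      ε = fun i => ε (i + (n : Fin (k + 1)))).card ≤ Fintype.card ι ^ n := by
  have hcard : (Finset.univ : Finset (Fin n → ι)).card = Fintype.card ι ^ n := by simp
  rw [← hcard]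
  refine Finset.card_le_card_of_injOn (fun ε j => ε ((j : ℕ) : Fin (k + 1)))
    (fun _ _ => Finset.mem_coe.mpr (Finset.mem_univ _)) ?_
  intro ε hε η hη h
  simp only [Finset.coe_filter, Finset.mem_univ, true_and, Set.mem_ofPred_eq] at hε hη
  have key (m : ℕ) : m < k + 1 → ε (m : Fin (k + 1)) = η (m : Fin (k + 1)) := by
    induction m using Nat.strong_induction_on with
    | _ m ih =>
      intro hm
      by_cases hmn : m < n
      · exact congrFun h ⟨m, hmn⟩
      · have hcast : (m : Fin (k + 1)) = ((m - n : ℕ) : Fin (k + 1)) + (n : Fin (k + 1)) := by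
          rw [← Nat.cast_add, Nat.sub_add_cancel (not_lt.mp hmn)]
        have h₁ := congrFun hε ((m - n : ℕ) : Fin (k + 1))
        have h₂ := congrFun hη ((m - n : ℕ) : Fin (k + 1))
        rw [← hcast] at h₁ h₂
        rw [← h₁, ← h₂]
        exact ih _ (by omega) (by omega)
  funext i
  simpa using key i i.isLt

/-- The average of `g` over a multiset. -/
noncomputable def Multiset.mean {α E : Type*} [AddCommMonoid E] [Module ℝ E] (s : Multiset α)
    (g : α → E) : E :=
  (s.card : ℝ)⁻¹ • (s.map g).sum

namespace Multiset

variable {α E : Type*}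

theorem mean_const [AddCommMonoid E] [Module ℝ E] {s : Multiset α} (hs : 0 < s.card) (c : E) :
    s.mean (fun _ => c) = c := by
  have : (s.card : ℝ) ≠ 0 := by positivity
  rw [mean, map_const', sum_replicate, ← Nat.cast_smul_eq_nsmul ℝ, inv_smul_smul₀ this]

theorem mean_add [AddCommMonoid E] [Module ℝ E] (s : Multiset α) (g h : α → E) :
    s.mean (fun x => g x + h x) = s.mean g + s.mean h := by
  rw [mean, sum_map_add, smul_add, mean, mean]

theorem mean_const_mul [Ring E] [Algebra ℝ E] (s : Multiset α) (c : E) (g : α → E) :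
    s.mean (fun x => c * g x) = c * s.mean g := by
  rw [mean, sum_map_mul_left, mean, mul_smul_comm]

theorem mean_sub [AddCommGroup E] [Module ℝ E] (s : Multiset α) (g h : α → E) :
    s.mean (fun x => g x - h x) = s.mean g - s.mean h := by
  rw [mean, sum_map_sub, smul_sub, mean, mean]

theorem norm_mean_le_mean [SeminormedAddCommGroup E] [NormedSpace ℝ E] {s : Multiset α} {g : α → E}
    {h : α → ℝ} (hgh : ∀ x ∈ s, ‖g x‖ ≤ h x) : ‖s.mean g‖ ≤ s.mean h := by
  rw [mean, mean, norm_smul, smul_eq_mul, Real.norm_of_nonneg (by positivity)]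
  gcongr
  refine (norm_multiset_sum_le _).trans ?_
  rw [map_map]
  exact sum_map_le_sum_map _ _ hgh

theorem norm_mean_le [SeminormedAddCommGroup E] [NormedSpace ℝ E] {s : Multiset α}
    (hs : 0 < s.card) {g : α → E} {c : ℝ} (hg : ∀ x ∈ s, ‖g x‖ ≤ c) : ‖s.mean g‖ ≤ c :=
  (norm_mean_le_mean hg).trans_eq (mean_const hs c)

end Multiset

open Filter Topology AddCircle in
/-- **Weyl's criterion** for a sequence of finite multisets on the circle. -/
theorem tendsto_mean_of_tendsto_mean_fourier {T : ℝ} [Fact (0 < T)]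
    {S : ℕ → Multiset (AddCircle T)} (hS : ∀ k, 0 < (S k).card)
    (hang : ∀ n : ℤ, n ≠ 0 → Tendsto (fun k => (S k).mean (fourier n)) atTop (𝓝 0))
    (g : C(AddCircle T, ℂ)) :
    Tendsto (fun k => (S k).mean g) atTop (𝓝 (∫ x, g x ∂haarAddCircle)) := by
  have hint (g : C(AddCircle T, ℂ)) : MeasureTheory.Integrable g haarAddCircle :=
    g.continuous.integrable_of_hasCompactSupport (HasCompactSupport.of_compactSpace g)
  have hspan : ∀ p ∈ Submodule.span ℂ (Set.range (fourier (T := T))),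
      Tendsto (fun k => (S k).mean p) atTop (𝓝 (∫ x, p x ∂haarAddCircle)) := by
    intro p hp
    induction hp using Submodule.span_induction with
    | mem p hp =>
      obtain ⟨n, rfl⟩ := hp
      have hcoeff := congrFun (fourierCoeff_fourier (T := T) n) 0
      simp only [fourierCoeff, neg_zero, fourier_zero, one_smul] at hcoeff
      rw [hcoeff]
      by_cases hn : n = 0
      · subst hn
        simp only [Pi.single_eq_same]
        have : (fun k => (S k).mean (fourier (T := T) 0)) = fun _ => 1 := by
          funext k
          rw [← Multiset.mean_const (hS k) (1 : ℂ)]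
          congr 1
          funext x
          exact fourier_zero
        rw [this]
        exact tendsto_const_nhds
      · rw [Pi.single_eq_of_ne (Ne.symm hn)]
        exact hang n hn
    | zero => simp [Multiset.mean]
    | add p q _ _ hp hq =>
      have h := hp.add hq
      rw [← MeasureTheory.integral_add (hint p) (hint q)] at h
      exact h.congr fun k => (Multiset.mean_add _ _ _).symm
    | smul c p _ hp =>
      have h := hp.const_mul c
      rw [← MeasureTheory.integral_const_mul] at h
      exact h.congr fun k => (Multiset.mean_const_mul _ _ _).symm
  rw [Metric.tendsto_atTop]
  intro ε hε
  have hg : g ∈ closure (Submodule.span ℂ (Set.range (fourier (T := T))) : Set _) := by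
    rw [← Submodule.topologicalClosure_coe, span_fourier_closure_eq_top]
    trivial
  obtain ⟨p, hp, hgp⟩ := Metric.mem_closure_iff.mp hg (ε / 3) (by positivity)
  obtain ⟨N, hN⟩ := Metric.tendsto_atTop.mp (hspan p hp) (ε / 3) (by positivity)
  refine ⟨N, fun k hk => ?_⟩
  have hle (x : AddCircle T) : ‖g x - p x‖ ≤ ε / 3 := by
    rw [← dist_eq_norm]
    exact (ContinuousMap.dist_apply_le_dist x).trans hgp.le
  have h₁ : dist ((S k).mean g) ((S k).mean p) ≤ ε / 3 := by
    rw [dist_eq_norm, ← Multiset.mean_sub]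
    exact Multiset.norm_mean_le (hS k) fun x _ => hle x
  have h₂ : dist (∫ x, p x ∂haarAddCircle) (∫ x, g x ∂haarAddCircle) ≤ ε / 3 := by
    rw [dist_comm, dist_eq_norm, ← MeasureTheory.integral_sub (hint g) (hint p)]
    simpa using MeasureTheory.norm_integral_le_of_norm_le_const
      (μ := haarAddCircle) (Eventually.of_forall hle)
  have h₃ := hN k hk
  linarith [dist_triangle4 ((S k).mean g) ((S k).mean p) (∫ x, p x ∂haarAddCircle)
    (∫ x, g x ∂haarAddCircle)]

/-- On a compact annulus, radial oscillation is controlled by the squared logarithmic distance. -/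
theorem exists_norm_sub_le_add_mul_sq_log {f : ℂ → ℂ} (hf : Continuous f) (b r : ℝ) {ε : ℝ}
    (hε : 0 < ε) :
    ∃ A : ℝ, 0 ≤ A ∧ ∀ z : ℂ, z ≠ 0 → |Real.log ‖z‖| ≤ b →
      ‖f z - f (Real.exp r * Complex.exp (z.arg * Complex.I))‖ ≤
        ε + A * (Real.log ‖z‖ - r) ^ 2 := by
  set R := max (Real.exp b) (Real.exp r)
  have hK : IsCompact (Metric.closedBall (0 : ℂ) R) := isCompact_closedBall 0 R
  obtain ⟨B, hB⟩ := hK.exists_bound_of_continuousOn hf.continuousOn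
  obtain ⟨δ, hδ, hfδ⟩ := Metric.uniformContinuousOn_iff.mp
    (hK.uniformContinuousOn_of_continuous hf.continuousOn) ε hε
  obtain ⟨η, hη, hexp⟩ := Metric.continuousAt_iff.mp (Real.continuous_exp.continuousAt (x := r)) δ hδ
  have hB0 : 0 ≤ B := (norm_nonneg _).trans (hB 0 (by simp [R, Real.exp_nonneg]))
  refine ⟨2 * B / η ^ 2, by positivity, fun z hz hzb => ?_⟩
  have hzpos : 0 < ‖z‖ := norm_pos_iff.mpr hz
  have hzexp : Real.exp (Real.log ‖z‖) = ‖z‖ := Real.exp_log hzpos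
  have hzR : z ∈ Metric.closedBall (0 : ℂ) R := by
    rw [mem_closedBall_zero_iff, ← hzexp]
    exact (Real.exp_le_exp.mpr ((le_abs_self _).trans hzb)).trans (le_max_left _ _)
  set v : ℂ := Real.exp r * Complex.exp (z.arg * Complex.I) with hv
  have hvR : v ∈ Metric.closedBall (0 : ℂ) R := by
    rw [mem_closedBall_zero_iff, hv, norm_mul, Complex.norm_exp_ofReal_mul_I, mul_one,
      Complex.norm_of_nonneg (Real.exp_nonneg r)]
    exact le_max_right _ _
  have hdist : dist z v = dist (Real.exp (Real.log ‖z‖)) (Real.exp r) := by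
    rw [hzexp, dist_eq_norm, hv]
    nth_rewrite 1 [← Complex.norm_mul_exp_arg_mul_I z]
    rw [← sub_mul, norm_mul, Complex.norm_exp_ofReal_mul_I, mul_one, ← Complex.ofReal_sub,
      Complex.norm_real, dist_eq_norm]
  by_cases h : dist (Real.log ‖z‖) r < η
  · have := hfδ z hzR v hvR (hdist.trans_lt (hexp h))
    rw [dist_eq_norm] at this
    have : 0 ≤ 2 * B / η ^ 2 * (Real.log ‖z‖ - r) ^ 2 := by positivity
    linarith
  · have hη2 : η ^ 2 ≤ (Real.log ‖z‖ - r) ^ 2 := by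
      rw [← sq_abs (Real.log ‖z‖ - r)]
      gcongr
      exact not_lt.mp h
    have h2B : 2 * B ≤ 2 * B / η ^ 2 * (Real.log ‖z‖ - r) ^ 2 := by
      rw [div_mul_eq_mul_div, le_div_iff₀ (by positivity)]
      gcongr
    linarith [norm_sub_le (f z) (f v), hB z hzR, hB v hvR]

open Filter Topology in
/-- Concentration of the moduli and cancellation of the angular moments imply
equidistribution on a circle. -/
theorem tendsto_mean_circle {S : ℕ → Multiset ℂ} {b r : ℝ} (hS : ∀ k, 0 < (S k).card)
    (hb : ∀ k, ∀ z ∈ S k, z ≠ 0 ∧ |Real.log ‖z‖| ≤ b)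
    (hlog : Tendsto (fun k => (S k).mean fun z => (Real.log ‖z‖ - r) ^ 2) atTop (𝓝 0))
    (hang : ∀ n : ℕ, 0 < n → Tendsto (fun k => (S k).mean fun z => (z / ‖z‖) ^ n) atTop (𝓝 0))
    {f : ℂ → ℂ} (hf : Continuous f) :
    Tendsto (fun k => (S k).mean f) atTop (𝓝 (((2 * Real.pi : ℝ) : ℂ)⁻¹ *
      ∫ θ in (0 : ℝ)..(2 * Real.pi), f (Real.exp r * Complex.exp (θ * Complex.I)))) := by
  have : Fact (0 < 2 * Real.pi) := ⟨Real.two_pi_pos⟩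
  let g : C(AddCircle (2 * Real.pi), ℂ) :=
    ⟨fun x => f (Real.exp r * (AddCircle.toCircle x : ℂ)), by
      have := AddCircle.continuous_toCircle (T := 2 * Real.pi)
      fun_prop⟩
  have hgcoe (θ : ℝ) : g (θ : AddCircle (2 * Real.pi)) =
      f (Real.exp r * Complex.exp (θ * Complex.I)) := by
    simp [g, AddCircle.toCircle_apply_mk]
  have hfourier (n : ℤ) (z : ℂ) (hz : z ≠ 0) :
      fourier n (z.arg : AddCircle (2 * Real.pi)) = (z / ‖z‖) ^ n := by
    have hz' : (‖z‖ : ℂ) ≠ 0 := by simpa using hz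
    have hu : z / ‖z‖ = Complex.exp (z.arg * Complex.I) := by
      rw [div_eq_iff hz', mul_comm, Complex.norm_mul_exp_arg_mul_I]
    rw [hu, ← Complex.exp_int_mul, fourier_coe_apply]
    congr 1
    have : (Real.pi : ℂ) ≠ 0 := by simp
    push_cast
    field_simp
  have hmean (k : ℕ) (h : AddCircle (2 * Real.pi) → ℂ) :
      ((S k).map fun z : ℂ => (z.arg : AddCircle (2 * Real.pi))).mean h =
        (S k).mean fun z => h (z.arg : AddCircle (2 * Real.pi)) := by
    simp [Multiset.mean, Multiset.map_map]
  have hpos (n : ℕ) (hn : 0 < n) : Tendsto (fun k => (S k).mean fun z : ℂ =>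
      fourier n (z.arg : AddCircle (2 * Real.pi))) atTop (𝓝 0) := by
    refine (hang n hn).congr fun k => ?_
    rw [Multiset.mean, Multiset.mean]
    congr 2
    exact Multiset.map_congr rfl fun z hz => by rw [hfourier n z (hb k z hz).1, zpow_natCast]
  have hneg (n : ℤ) (k : ℕ) : (S k).mean (fun z : ℂ =>
      fourier (-n) (z.arg : AddCircle (2 * Real.pi))) = star ((S k).mean fun z : ℂ =>
      fourier n (z.arg : AddCircle (2 * Real.pi))) := by
    simp only [Multiset.mean, fourier_neg, star_smul, star_trivial, Complex.star_def,
      map_multiset_sum, Multiset.map_map, Function.comp_def]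
  have hweyl := tendsto_mean_of_tendsto_mean_fourier
    (S := fun k => (S k).map fun z : ℂ => (z.arg : AddCircle (2 * Real.pi)))
    (by simpa using hS) (fun n hn => by
      simp only [hmean]
      rcases Int.natAbs_eq n with h | h
      · rw [h]
        exact hpos _ (Int.natAbs_pos.mpr hn)
      · rw [h]
        simp only [hneg]
        simpa using (hpos _ (Int.natAbs_pos.mpr hn)).star) g
  rw [AddCircle.integral_haarAddCircle, ← AddCircle.intervalIntegral_preimage (2 * Real.pi) 0,
    zero_add] at hweyl
  simp only [hmean, hgcoe, Complex.real_smul, Complex.ofReal_inv] at hweyl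
  refine (tendsto_iff_of_dist ?_).mp hweyl
  rw [Metric.tendsto_atTop]
  intro ε hε
  obtain ⟨A, hA, hfA⟩ := exists_norm_sub_le_add_mul_sq_log hf b r (half_pos hε)
  have hlogA := hlog.const_mul A
  rw [mul_zero] at hlogA
  obtain ⟨N, hN⟩ := Metric.tendsto_atTop.mp hlogA (ε / 2) (half_pos hε)
  refine ⟨N, fun k hk => ?_⟩
  have h₁ := (abs_lt.mp ((Real.dist_0_eq_abs _).symm.trans_lt (hN k hk))).2
  rw [Real.dist_0_eq_abs, abs_of_nonneg dist_nonneg, dist_comm, dist_eq_norm, ← Multiset.mean_sub]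
  refine (Multiset.norm_mean_le_mean fun z hz => hfA z (hb k z hz).1 (hb k z hz).2).trans_lt ?_
  rw [Multiset.mean_add, Multiset.mean_const (hS k), Multiset.mean_const_mul]
  linarith

/-- `Mbaker` is diagonalizable, with eigenvalues `d 0, d 1, d 2 = 0`. -/
theorem exists_diagonalization_Mbaker :
    ∃ (P : Matrix (Fin 3) (Fin 3) ℂ) (d : Fin 3 → ℂ), IsUnit P ∧
      Mbaker * P = P * Matrix.diagonal d ∧ d 0 ≠ 0 ∧ d 1 ≠ 0 ∧ d 2 = 0 ∧
      ‖d 0 * d 1‖ = (Real.sqrt 3)⁻¹ := by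
  set w : ℂ := Complex.exp (2 * Real.pi * Complex.I / 3) with hw
  set a : ℂ := ((Real.sqrt 3 : ℝ) : ℂ)⁻¹ with ha
  have ha2 : a ^ 2 = 1 / 3 := by
    rw [ha, inv_pow, ← Complex.ofReal_pow, Real.sq_sqrt (by norm_num)]
    norm_num
  have ha0 : a ≠ 0 := by
    rintro h
    rw [h] at ha2
    norm_num at ha2
  have hprim : IsPrimitiveRoot w 3 := by
    simpa [hw] using Complex.isPrimitiveRoot_exp 3 (by norm_num)
  have hw3 : w ^ 3 = 1 := hprim.pow_eq_one
  have hsum : 1 + w + w ^ 2 = 0 := by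
    simpa [Finset.sum_range_succ] using hprim.geom_sum_eq_zero (by norm_num)
  have hwn : ‖w‖ = 1 := hprim.norm'_eq_one (by norm_num)
  have hM : Mbaker = !![a, 0, a; a, 0, a * w ^ 2; a, 0, a * w] := by
    have h2 : Complex.exp (2 * Real.pi * Complex.I * 2 / 3) = w ^ 2 := by
      rw [hw, ← Complex.exp_nat_mul]
      congr 1
      push_cast
      ring
    have h4 : Complex.exp (2 * Real.pi * Complex.I * 2 * 2 / 3) = w := by
      have : w = w ^ 4 := by linear_combination -w * hw3
      rw [this, hw, ← Complex.exp_nat_mul]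
      congr 1
      push_cast
      ring
    ext i j
    fin_cases i <;> fin_cases j <;> simp [Mbaker, ← ha, h2, h4]
  obtain ⟨s, hs⟩ := IsAlgClosed.exists_pow_nat_eq ((4 - 3 * w) / 3) (n := 2) (by norm_num)
  have hs0 : s ≠ 0 := by
    rintro rfl
    have : 3 * w = 4 := by linear_combination 3 * hs
    have := congrArg norm this
    rw [norm_mul, hwn] at this
    norm_num at this
  obtain ⟨x, y, hxy, htr, hdet⟩ : ∃ x y : ℂ, x ≠ y ∧ x + y = a * (1 + w) ∧
      x * y = a ^ 2 * (w - 1) := by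
    refine ⟨(a * (1 + w) + s) / 2, (a * (1 + w) - s) / 2, fun h => hs0 ?_, by ring, ?_⟩
    · linear_combination h
    · linear_combination -hs / 4 + (1 / 4 * (1 + w) ^ 2 - (w - 1)) * ha2 + 1 / 12 * hsum
  have hnorm : ‖x * y‖ = (Real.sqrt 3)⁻¹ := by
    have h3 : ‖w - 1‖ ^ 2 = 3 := by
      rw [← norm_pow, show (w - 1) ^ 2 = -3 * w by linear_combination hsum, norm_mul, hwn]
      norm_num
    have h3' : ‖w - 1‖ = Real.sqrt 3 := by
      rw [← h3, Real.sqrt_sq (norm_nonneg _)]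
    have h4 : Real.sqrt 3 * Real.sqrt 3 = 3 := Real.mul_self_sqrt (by norm_num)
    rw [hdet, ha2, norm_mul, h3']
    field_simp
    norm_num
  have hx : x ≠ 0 := by
    rintro rfl
    rw [zero_mul, norm_zero] at hnorm
    have : 0 < (Real.sqrt 3)⁻¹ := by positivity
    linarith
  have hy : y ≠ 0 := by
    rintro rfl
    rw [mul_zero, norm_zero] at hnorm
    have : 0 < (Real.sqrt 3)⁻¹ := by positivity
    linarith
  have hxq : x ^ 2 = a * (1 + w) * x - a ^ 2 * (w - 1) := by linear_combination x * htr - hdet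
  have hyq : y ^ 2 = a * (1 + w) * y - a ^ 2 * (w - 1) := by linear_combination y * htr - hdet
  refine ⟨!![a, a, 0;
    (a * a + a * w ^ 2 * (x - a)) / x, (a * a + a * w ^ 2 * (y - a)) / y, 1;
    x - a, y - a, 0], ![x, y, 0], ?_, ?_, hx, hy, rfl, hnorm⟩
  · rw [Matrix.isUnit_iff_isUnit_det, isUnit_iff_ne_zero, Matrix.det_fin_three]
    have : a * (x - y) ≠ 0 := mul_ne_zero ha0 (sub_ne_zero.mpr hxy)
    simp only [Matrix.of_apply, Matrix.cons_val', Matrix.cons_val_zero, Matrix.cons_val_one,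
      Matrix.cons_val]
    intro h
    exact this (by linear_combination h)
  · rw [hM]
    ext i j
    fin_cases i <;> fin_cases j <;>
      simp [Matrix.mul_apply, Fin.sum_univ_three, Matrix.diagonal_apply, hx, hy]
    · ring
    · ring
    · linear_combination -hxq
    · linear_combination -hyq

/-- Second moment of a sum of centered weights over words. -/
theorem sum_prod_mul_sum_sq {ι : Type*} [Fintype ι] {c x : ι → ℝ} (hx : ∑ a, c a * x a = 0)
    (k : ℕ) :
    (∑ ε : Fin (k + 1) → ι, (∏ i, c (ε i)) * (∑ i, x (ε i)) ^ 2) =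
      (k + 1) * (∑ a, c a * x a ^ 2) * (∑ a, c a) ^ k := by
  have hprod (k : ℕ) : ∑ ε : Fin k → ι, ∏ i, c (ε i) = (∑ a, c a) ^ k :=
    (Fintype.sum_pow c k).symm
  have hstep (k : ℕ) : (∑ ε : Fin (k + 1) → ι, (∏ i, c (ε i)) * (∑ i, x (ε i)) ^ 2) =
      (∑ a, c a * x a ^ 2) * (∑ a, c a) ^ k +
        (∑ a, c a) * ∑ ε : Fin k → ι, (∏ i, c (ε i)) * (∑ i, x (ε i)) ^ 2 := by
    have hcross : (∑ a, c a * x a) * ∑ ε : Fin k → ι, 2 * ((∏ i, c (ε i)) * ∑ i, x (ε i)) = 0 := by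
      rw [hx, zero_mul]
    rw [← hprod, ← add_zero (_ * _ + _ * _), ← hcross, ← (Fin.consEquiv fun _ => ι).sum_comp,
      Fintype.sum_prod_type]
    simp only [Finset.sum_mul_sum, ← Finset.sum_add_distrib]
    refine Finset.sum_congr rfl fun a _ => Finset.sum_congr rfl fun ε _ => ?_
    simp only [Fin.consEquiv_apply, Fin.prod_univ_succ, Fin.sum_univ_succ, Fin.cons_zero,
      Fin.cons_succ]
    ring
  induction k with
  | zero => rw [hstep]; simp
  | succ k ih => rw [hstep, ih]; push_cast; ring

open scoped Classical in
/-- The nonzero eigenvalues, with algebraic multiplicity, of the shift matrix of `diagonal d`. -/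
noncomputable def nonzeroEigenvalues {ι : Type*} [Fintype ι] [DecidableEq ι] (d : ι → ℂ) (k : ℕ) :
    Multiset ℂ :=
  (shiftMatrix (Matrix.diagonal d) k).charpoly.roots.filter fun z => z ≠ 0

theorem Multiset.sum_map_filter_ne_zero {E : Type*} [AddCommMonoid E] [DecidableEq ℂ]
    (s : Multiset ℂ) (g : ℂ → E) :
    ((s.filter fun z => z ≠ 0).map g).sum = (s.map fun z => if z = 0 then 0 else g z).sum := by
  induction s using Multiset.induction_on with
  | empty => simp
  | cons z s ih => by_cases hz : z = 0 <;> simp [hz, ← ih]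

theorem prod_ite_eq_zero {α M R : Type*} [CommMonoidWithZero M] [Nontrivial M] [NoZeroDivisors M]
    [DecidableEq M] [CommMonoidWithZero R] (s : Finset α) (g : α → M) :
    (∏ i ∈ s, if g i = 0 then (0 : R) else 1) = if ∏ i ∈ s, g i = 0 then 0 else 1 := by
  by_cases h : ∏ i ∈ s, g i = 0
  · obtain ⟨i, hi, hgi⟩ := Finset.prod_eq_zero_iff.mp h
    rw [if_pos h]
    exact Finset.prod_eq_zero hi (if_pos hgi)
  · rw [if_neg h]
    exact Finset.prod_eq_one fun i hi => if_neg (Finset.prod_ne_zero_iff.mp h i hi)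

section Words

variable {ι : Type*} [Fintype ι] [DecidableEq ι] (d : ι → ℂ)

theorem sum_nonzeroEigenvalues (k m : ℕ) (G : ℂ → ℂ) :
    ((nonzeroEigenvalues d k).map fun z => z ^ m * G (z ^ (k + 1))).sum =
      ∑ ε : Fin (k + 1) → ι, (shiftMatrix (Matrix.diagonal d) k ^ m) ε ε *
        ((∏ i, if d (ε i) = 0 then 0 else 1) * G (∏ i, d (ε i))) := by
  classical
  have h := sum_roots_charpoly_pow_mul_apply_pow (shiftMatrix_diagonal_pow_length d k) m
    fun w => if w = 0 then 0 else G w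
  rw [nonzeroEigenvalues, Multiset.sum_map_filter_ne_zero]
  convert h using 2
  · refine Multiset.map_congr rfl fun z _ => ?_
    by_cases hz : z = 0 <;> simp [hz]
  · rename_i ε _
    rw [prod_ite_eq_zero, ite_mul, zero_mul, one_mul]

theorem card_nonzeroEigenvalues (k : ℕ) :
    ((nonzeroEigenvalues d k).card : ℂ) = (∑ a, if d a = 0 then 0 else 1) ^ (k + 1) := by
  have h := sum_nonzeroEigenvalues d k 0 fun _ => 1
  simp only [pow_zero, one_mul, mul_one, Matrix.one_apply_eq, Multiset.map_const',
    Multiset.sum_replicate, nsmul_eq_mul] at h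
  rw [h, Fintype.sum_pow]

theorem mem_nonzeroEigenvalues_log_norm_le {b : ℝ} (hb : ∀ a, |Real.log ‖d a‖| ≤ b) {k : ℕ}
    {z : ℂ} (hz : z ∈ nonzeroEigenvalues d k) : z ≠ 0 ∧ |Real.log ‖z‖| ≤ b := by
  rw [nonzeroEigenvalues, Multiset.mem_filter] at hz
  obtain ⟨hroot, hz0⟩ := hz
  refine ⟨hz0, ?_⟩
  have hspec := spectrum.pow_mem_pow _ (k + 1)
    (Matrix.mem_spectrum_of_isRoot_charpoly (Polynomial.isRoot_of_mem_roots hroot))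
  rw [shiftMatrix_diagonal_pow_length, spectrum_diagonal] at hspec
  obtain ⟨ε, hε⟩ := hspec
  have hne : ∀ i ∈ Finset.univ, ‖d (ε i)‖ ≠ 0 := by
    have h : ∏ i, d (ε i) ≠ 0 := by
      simp only at hε
      rw [hε]
      exact pow_ne_zero _ hz0
    exact fun i hi => norm_ne_zero_iff.mpr (Finset.prod_ne_zero_iff.mp h i hi)
  have hlog := congrArg (fun w : ℂ => Real.log ‖w‖) hε
  simp only [norm_prod, norm_pow, Real.log_pow] at hlog
  rw [Real.log_prod hne] at hlog
  have hle : |∑ i, Real.log ‖d (ε i)‖| ≤ (k + 1 : ℕ) * b := by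
    refine (Finset.abs_sum_le_sum_abs _ _).trans ?_
    simpa using Finset.sum_le_card_nsmul Finset.univ _ b fun i _ => hb (ε i)
  rw [hlog, abs_mul, Nat.abs_cast] at hle
  exact le_of_mul_le_mul_left hle (by positivity)

theorem sum_sq_log_nonzeroEigenvalues {r : ℝ}
    (hr : ∑ a, (if d a = 0 then 0 else 1) * (Real.log ‖d a‖ - r) = 0) (k : ℕ) :
    ((nonzeroEigenvalues d k).map fun z => (Real.log ‖z‖ - r) ^ 2).sum =
      (∑ a, (if d a = 0 then 0 else 1) * (Real.log ‖d a‖ - r) ^ 2) *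
        (∑ a, if d a = 0 then 0 else 1) ^ k / (k + 1) := by
  have hk : (k + 1 : ℝ) ≠ 0 := by positivity
  have h := sum_nonzeroEigenvalues d k 0 fun w => (((Real.log ‖w‖ / (k + 1) - r) ^ 2 : ℝ) : ℂ)
  have hcast : (((nonzeroEigenvalues d k).map fun z => (Real.log ‖z‖ - r) ^ 2).sum : ℂ) =
      ((nonzeroEigenvalues d k).map fun z => z ^ 0 *
        (((Real.log ‖z ^ (k + 1)‖ / (k + 1) - r) ^ 2 : ℝ) : ℂ)).sum := by
    rw [← Complex.ofRealHom_eq_coe, map_multiset_sum, Multiset.map_map]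
    congr 1
    refine Multiset.map_congr rfl fun z _ => ?_
    rw [norm_pow, Real.log_pow, Function.comp_apply, Complex.ofRealHom_eq_coe, pow_zero, one_mul]
    push_cast
    rw [mul_div_cancel_left₀ _ (by exact_mod_cast hk)]
  rw [h] at hcast
  have hmoment := sum_prod_mul_sum_sq hr k
  rw [← Complex.ofReal_inj, hcast]
  have hterm (ε : Fin (k + 1) → ι) :
      (shiftMatrix (Matrix.diagonal d) k ^ 0) ε ε * ((∏ i, if d (ε i) = 0 then 0 else 1) *
        (((Real.log ‖∏ i, d (ε i)‖ / (k + 1) - r) ^ 2 : ℝ) : ℂ)) =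
      (((∏ i, if d (ε i) = 0 then 0 else 1) * (∑ i, (Real.log ‖d (ε i)‖ - r)) ^ 2 /
        (k + 1) ^ 2 : ℝ) : ℂ) := by
    rw [pow_zero, Matrix.one_apply_eq, one_mul]
    rw [prod_ite_eq_zero, prod_ite_eq_zero]
    by_cases hw : ∏ i, d (ε i) = 0
    · simp [hw]
    · have hne := Finset.prod_ne_zero_iff.mp hw
      rw [if_neg hw, if_neg hw, one_mul, one_mul, norm_prod,
        Real.log_prod fun i hi => norm_ne_zero_iff.mpr (hne i hi), Finset.sum_sub_distrib,
        ← div_pow]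
      congr 2
      simp only [Finset.sum_const, Finset.card_univ, Fintype.card_fin, nsmul_eq_mul]
      push_cast
      field_simp
  rw [Finset.sum_congr rfl fun ε _ => hterm ε, ← Complex.ofReal_sum, ← Finset.sum_div, hmoment]
  congr 1
  field_simp

theorem norm_sum_angular_nonzeroEigenvalues_le {b : ℝ} (hb : ∀ a, |Real.log ‖d a‖| ≤ b) {n : ℕ}
    (hn : 0 < n) (k : ℕ) :
    ‖((nonzeroEigenvalues d k).map fun z : ℂ => (z / ‖z‖) ^ n).sum‖ ≤
      (Fintype.card ι : ℝ) ^ n * (Real.exp b ^ n * Real.exp b ^ n) := by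
  have hk : (k + 1 : ℝ) ≠ 0 := by positivity
  set G : ℂ → ℂ := fun w => (Real.exp (-(n * (Real.log ‖w‖ / (k + 1)))) : ℝ) with hG
  have h := sum_nonzeroEigenvalues d k n G
  have hcongr : (nonzeroEigenvalues d k).map (fun z => z ^ n * G (z ^ (k + 1))) =
      (nonzeroEigenvalues d k).map fun z : ℂ => (z / ‖z‖) ^ n := by
    refine Multiset.map_congr rfl fun z hz => ?_
    have hz0 := norm_pos_iff.mpr (mem_nonzeroEigenvalues_log_norm_le d hb hz).1
    rw [hG]
    simp only [norm_pow, Real.log_pow]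
    push_cast
    rw [mul_div_cancel_left₀ _ (by exact_mod_cast hk), div_pow, div_eq_mul_inv, Complex.exp_neg,
      Complex.exp_nat_mul, ← Complex.ofReal_exp, Real.exp_log hz0]
  rw [hcongr] at h
  rw [h]
  have hd (a : ι) : ‖d a‖ ≤ Real.exp b := by
    by_cases ha : d a = 0
    · rw [ha, norm_zero]
      exact Real.exp_nonneg b
    · rw [← Real.log_le_iff_le_exp (norm_pos_iff.mpr ha)]
      exact (le_abs_self _).trans (hb a)
  have hGle (ε : Fin (k + 1) → ι) :
      ‖(∏ i, if d (ε i) = 0 then (0 : ℂ) else 1) * G (∏ i, d (ε i))‖ ≤ Real.exp b ^ n := by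
    rw [prod_ite_eq_zero]
    by_cases hw : ∏ i, d (ε i) = 0
    · rw [if_pos hw, zero_mul, norm_zero]
      positivity
    · have hne := Finset.prod_ne_zero_iff.mp hw
      rw [if_neg hw, one_mul, hG]
      simp only
      rw [Complex.norm_of_nonneg (Real.exp_nonneg _), ← Real.exp_nat_mul, Real.exp_le_exp,
        ← mul_neg]
      gcongr
      rw [norm_prod, Real.log_prod fun i hi => norm_ne_zero_iff.mpr (hne i hi), ← neg_div,
        div_le_iff₀ (by positivity), ← Finset.sum_neg_distrib, mul_comm]
      simpa using Finset.sum_le_card_nsmul Finset.univ _ b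
        fun i _ => (neg_le_abs _).trans (hb (ε i))
  refine (norm_sum_le _ _).trans ?_
  simp only [shiftMatrix_diagonal_pow_apply, norm_mul (ite _ _ _)]
  rw [← Finset.sum_subset (Finset.filter_subset _ _) fun ε _ hε => by
    rw [if_neg fun h => hε (Finset.mem_filter.mpr ⟨Finset.mem_univ ε, h⟩), norm_zero, zero_mul]]
  refine (Finset.sum_le_card_nsmul _ _ (Real.exp b ^ n * Real.exp b ^ n) fun ε hε => ?_).trans ?_
  · rw [if_pos (Finset.mem_filter.mp hε).2]
    refine mul_le_mul ?_ (hGle ε) (norm_nonneg _) (by positivity)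
    rw [norm_prod]
    refine (Finset.prod_le_prod (fun _ _ => norm_nonneg _) fun _ _ => hd _).trans_eq ?_
    simp
  · rw [nsmul_eq_mul]
    gcongr
    exact_mod_cast card_filter_shift_eq_le hn

open Filter Topology in
/-- If at least two of the weights `d` are nonzero, then the nonzero eigenvalues of the shift
matrix equidistribute on the circle whose radius is the geometric mean of their moduli. -/
theorem tendsto_mean_nonzeroEigenvalues {r : ℝ}
    (hr : ∑ a, (if d a = 0 then 0 else 1) * (Real.log ‖d a‖ - r) = 0) {N : ℕ} (hN : 2 ≤ N)
    (hdN : (Finset.univ.filter fun a => d a ≠ 0).card = N)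
    {f : ℂ → ℂ} (hf : Continuous f) :
    Tendsto (fun k => ((N : ℂ) ^ (k + 1))⁻¹ * ((nonzeroEigenvalues d k).map f).sum) atTop
      (𝓝 (((2 * Real.pi : ℝ) : ℂ)⁻¹ *
        ∫ θ in (0 : ℝ)..(2 * Real.pi), f (Real.exp r * Complex.exp (θ * Complex.I)))) := by
  have hN0 : (N : ℝ) ≠ 0 := by positivity
  have hcount (R : Type) [CommRing R] : (∑ a, if d a = 0 then (0 : R) else 1) = N := by
    rw [← hdN, Finset.card_filter]
    push_cast
    exact Finset.sum_congr rfl fun a _ => by by_cases h : d a = 0 <;> simp [h]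
  have hcard (k : ℕ) : (nonzeroEigenvalues d k).card = N ^ (k + 1) := by
    have h := card_nonzeroEigenvalues d k
    rw [hcount] at h
    exact_mod_cast h
  obtain ⟨b, hb⟩ : ∃ b : ℝ, ∀ a, |Real.log ‖d a‖| ≤ b := by
    obtain ⟨b, hb⟩ := (Set.finite_range fun a => |Real.log ‖d a‖|).bddAbove
    exact ⟨b, fun a => hb ⟨a, rfl⟩⟩
  have key := tendsto_mean_circle (S := nonzeroEigenvalues d) (b := b) (r := r)
    (fun k => by rw [hcard]; positivity)
    (fun k z hz => mem_nonzeroEigenvalues_log_norm_le d hb hz) ?_ ?_ hf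
  · refine key.congr fun k => ?_
    rw [Multiset.mean, hcard, Complex.real_smul]
    push_cast
    rfl
  · set V := ∑ a, (if d a = 0 then 0 else 1) * (Real.log ‖d a‖ - r) ^ 2
    have h := (tendsto_one_div_add_atTop_nhds_zero_nat (𝕜 := ℝ)).const_mul (V / N)
    rw [mul_zero] at h
    refine h.congr fun k => ?_
    rw [Multiset.mean, sum_sq_log_nonzeroEigenvalues d hr, hcard, hcount, smul_eq_mul]
    push_cast
    field_simp
    ring
  · intro n hn
    set B := (Fintype.card ι : ℝ) ^ n * (Real.exp b ^ n * Real.exp b ^ n)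
    have hlt : (N : ℝ)⁻¹ < 1 := inv_lt_one_of_one_lt₀ (by exact_mod_cast hN)
    have h := ((tendsto_add_atTop_iff_nat 1).mpr
      (tendsto_pow_atTop_nhds_zero_of_lt_one (by positivity) hlt)).mul_const B
    rw [zero_mul] at h
    refine squeeze_zero_norm (fun k => ?_) h
    rw [Multiset.mean, hcard, norm_smul, Real.norm_of_nonneg (by positivity), Nat.cast_pow, inv_pow]
    gcongr
    exact norm_sum_angular_nonzeroEigenvalues_le d hb hn k

end Words

open scoped Classical in
/-- the nonzero eigenvalues of `T_k`, weighted by algebraic multiplicity,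
equidistribute on the circle of radius `ρ = 3^{−1/4}`: for every continuous `f : ℂ → ℂ`,
`2^{−k} Σ_λ mult(λ)·f(λ) → (2π)^{−1} ∫₀^{2π} f(ρ·e^{iθ}) dθ`. -/
theorem stmt_7 (f : ℂ → ℂ) (hf : Continuous f) :
    Filter.Tendsto
      (fun k : ℕ => ((2 : ℂ) ^ k)⁻¹ *
        ((((Matrix.charpoly (Tbaker k)).roots).filter (fun z : ℂ => z ≠ 0)).map f).sum)
      Filter.atTop
      (nhds (((2 * Real.pi : ℝ) : ℂ)⁻¹ *
        ∫ θ in (0 : ℝ)..(2 * Real.pi),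
          f ((((3 : ℝ) ^ (-(1 / 4 : ℝ)) : ℝ) : ℂ) * Complex.exp (θ * Complex.I)))) := by
  obtain ⟨P, d, hP, hMP, h0, h1, h2, hnorm⟩ := exists_diagonalization_Mbaker
  set r : ℝ := (Real.log ‖d 0‖ + Real.log ‖d 1‖) / 2 with hr
  have hρ : ((3 : ℝ) ^ (-(1 / 4 : ℝ)) : ℝ) = Real.exp r := by
    rw [hr, ← Real.log_mul (norm_ne_zero_iff.mpr h0) (norm_ne_zero_iff.mpr h1), ← norm_mul, hnorm,
      Real.log_inv, Real.log_sqrt (by norm_num), Real.rpow_def_of_pos (by norm_num)]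
    congr 1
    ring
  have key := tendsto_mean_nonzeroEigenvalues d (r := r) (N := 2)
    (by simp only [Fin.sum_univ_three, if_neg h0, if_neg h1, if_pos h2, hr]; ring) le_rfl
    (by simp [Finset.card_filter, Fin.sum_univ_three, h0, h1, h2]) hf
  rw [← Filter.tendsto_add_atTop_iff_nat 1, hρ]
  refine key.congr fun k => ?_
  have hT : (Tbaker (k + 1)).charpoly = (shiftMatrix (Matrix.diagonal d) k).charpoly :=
    charpoly_shiftMatrix_eq hP hMP k
  rw [nonzeroEigenvalues, ← hT]
  norm_cast
end

section
/- Let C be the open baker's map with domain S, and define the forward trapped set Γ₋ as the set of points x ∈ [0,1)² admitting a full forward orbit: there exists a sequence (x_t)_{t∈ℕ} with x₀ = x, x_t ∈ S and x_{t+1} = C(x_t) for all t ∈ ℕ. Then Γ₋ = Can₀ × [0,1). -/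
/-- The domain `S = ([0,1/3) ∪ [2/3,1)) × [0,1)` of the open baker's map. -/
def bakerDomain : Set (ℝ × ℝ) :=
  (Set.Ico (0 : ℝ) (1 / 3) ∪ Set.Ico (2 / 3 : ℝ) 1) ×ˢ Set.Ico (0 : ℝ) 1

/-- The Cantor-like set `Can₀` of points of `[0,1)` all of whose ternary digits
(in the floor convention `digit_n(q) = ⌊3^{n+1}·q⌋ mod 3`) differ from `1`. -/
def Can0 : Set ℝ :=
  {q : ℝ | q ∈ Set.Ico (0 : ℝ) 1 ∧ ∀ n : ℕ, ⌊(3 : ℝ) ^ (n + 1) * q⌋ % 3 ≠ 1}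

/-- Adding an integer to `3 * q` does not change the later ternary digits of `q`. -/
theorem floor_three_pow_mul_sub_emod (q : ℝ) (k : ℤ) (n : ℕ) :
    ⌊(3 : ℝ) ^ (n + 1) * (3 * q - k)⌋ % 3 = ⌊(3 : ℝ) ^ (n + 2) * q⌋ % 3 := by
  have h : (3 : ℝ) ^ (n + 2) * q =
      (3 : ℝ) ^ (n + 1) * (3 * q - k) + ((3 * (3 ^ n * k) : ℤ) : ℝ) := by
    push_cast
    ring
  rw [h, Int.floor_add_intCast, Int.add_mul_emod_self_left]

/-- The first ternary digit of `q` differs from `1` exactly off the middle third. -/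
theorem floor_three_mul_emod_ne_one_iff {q : ℝ} (hq : q ∈ Set.Ico (0 : ℝ) 1) :
    ⌊3 * q⌋ % 3 ≠ 1 ↔ q ∈ Set.Ico (0 : ℝ) (1 / 3) ∪ Set.Ico (2 / 3 : ℝ) 1 := by
  obtain ⟨h0, h1⟩ := hq
  have hf0 : 0 ≤ ⌊3 * q⌋ := Int.floor_nonneg.2 (by linarith)
  have hf3 : ⌊3 * q⌋ < 3 := Int.floor_lt.2 (by push_cast; linarith)
  have hmod : ⌊3 * q⌋ % 3 = 1 ↔ ⌊3 * q⌋ = 1 := by omega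
  rw [Ne, hmod, Int.floor_eq_iff]
  simp only [Set.mem_union, Set.mem_Ico]
  push_cast
  constructor
  · intro h
    by_cases hq : q < 1 / 3
    · exact Or.inl ⟨h0, hq⟩
    · refine Or.inr ⟨?_, h1⟩
      by_contra hq'
      exact h ⟨by linarith, by linarith⟩
  · rintro (h | h) ⟨h2, h3⟩ <;> linarith [h.1, h.2]

theorem sub_mem_Can0 {q : ℝ} (k : ℤ) (hq : q ∈ Can0)
    (h : 3 * q - k ∈ Set.Ico (0 : ℝ) 1) : 3 * q - k ∈ Can0 := by
  refine ⟨h, fun n => ?_⟩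
  rw [floor_three_pow_mul_sub_emod]
  exact hq.2 (n + 1)

/-- for the open baker's map `C` with domain `S`, the forward trapped set
`Γ₋` — the set of points of `[0,1)²` admitting a full forward orbit — equals
`Can₀ × [0,1)`. -/
theorem stmt_12 (C : ℝ × ℝ → ℝ × ℝ)
    (hC0 : ∀ q p : ℝ, q ∈ Set.Ico (0 : ℝ) (1 / 3) → C (q, p) = (3 * q, p / 3))
    (hC2 : ∀ q p : ℝ, q ∈ Set.Ico (2 / 3 : ℝ) 1 → C (q, p) = (3 * q - 2, (p + 2) / 3)) :
    {x : ℝ × ℝ | x ∈ Set.Ico (0 : ℝ) 1 ×ˢ Set.Ico (0 : ℝ) 1 ∧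
        ∃ u : ℕ → ℝ × ℝ, u 0 = x ∧ ∀ t : ℕ, u t ∈ bakerDomain ∧ u (t + 1) = C (u t)} =
      Can0 ×ˢ Set.Ico (0 : ℝ) 1 := by
  ext ⟨q, p⟩
  constructor
  · rintro ⟨⟨hq, hp⟩, u, hu0, hu⟩
    refine ⟨⟨hq, fun n => ?_⟩, hp⟩
    have key : ∀ n t : ℕ, ⌊(3 : ℝ) ^ (n + 1) * (u t).1⌋ % 3 ≠ 1 := by
      intro n
      induction n with
      | zero =>
        intro t
        have h := (hu t).1.1
        rw [zero_add, pow_one]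
        refine (floor_three_mul_emod_ne_one_iff ?_).2 h
        rcases h with h | h <;> exact ⟨by linarith [h.1], by linarith [h.2]⟩
      | succ n ih =>
        intro t
        have hn := ih (t + 1)
        rw [(hu t).2] at hn
        rcases (hu t).1.1 with h | h
        · rw [hC0 (u t).1 (u t).2 h] at hn
          rw [← floor_three_pow_mul_sub_emod _ 0]
          simpa using hn
        · rw [hC2 (u t).1 (u t).2 h] at hn
          rw [← floor_three_pow_mul_sub_emod _ 2]
          simpa using hn
    simpa [hu0] using key n 0
  · rintro ⟨hq, hp⟩
    have hdom : Can0 ×ˢ Set.Ico (0 : ℝ) 1 ⊆ bakerDomain := by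
      rintro ⟨a, b⟩ ⟨ha, hb⟩
      exact ⟨(floor_three_mul_emod_ne_one_iff ha.1).1 (by simpa using ha.2 0), hb⟩
    have hmaps : Set.MapsTo C (Can0 ×ˢ Set.Ico (0 : ℝ) 1) (Can0 ×ˢ Set.Ico (0 : ℝ) 1) := by
      rintro ⟨a, b⟩ hab
      obtain ⟨hb0, hb1⟩ : b ∈ Set.Ico (0 : ℝ) 1 := hab.2
      rcases (hdom hab).1 with h | h
      · rw [hC0 a b h]
        obtain ⟨h0, h1⟩ : a ∈ Set.Ico (0 : ℝ) (1 / 3) := h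
        refine ⟨?_, by dsimp only; linarith, by dsimp only; linarith⟩
        simpa using sub_mem_Can0 0 hab.1 ⟨by push_cast; linarith, by push_cast; linarith⟩
      · rw [hC2 a b h]
        obtain ⟨h0, h1⟩ : a ∈ Set.Ico (2 / 3 : ℝ) 1 := h
        refine ⟨?_, by dsimp only; linarith, by dsimp only; linarith⟩
        simpa using sub_mem_Can0 2 hab.1 ⟨by push_cast; linarith, by push_cast; linarith⟩
    exact ⟨⟨hq.1, hp⟩, fun t => C^[t] (q, p), rfl, fun t =>
      ⟨hdom (hmaps.iterate t ⟨hq, hp⟩), Function.iterate_succ_apply' C t (q, p)⟩⟩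
end
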